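/- Let O = {x, y, z, t}, let ≺_a be the relation on O with exactly the pairs z ≺_a x, z ≺_a y, t ≺_a x, t ≺_a y, and let ≺_b be the strict linear order y ≺_b z ≺_b x ≺_b t. Then every infinite game with two players a and b, outcomes O, preferences ≺_a and ≺_b, played on a countable pruned tree T over a countable set Σ and whose outcome function v satisfies that v⁻¹({u}) is a quasi-difference set of [T] for every u ∈ O, has a subgame perfect equilibrium. -/

import Mathlib

/-! Basic setup: trees of finite sequences, their branches, the topology on the set of
branches, the Hausdorff difference hierarchy, quasi-difference sets, and infinite
games in extensive form. -/

/-- `T` is a tree over `α`: a set of finite sequences closed under taking prefixes. -/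
def IsTree {α : Type*} (T : Set (List α)) : Prop :=
  ∀ ⦃γ δ : List α⦄, γ <+: δ → δ ∈ T → γ ∈ T

/-- `succ(T, γ)`: the nodes of `T` extending `γ` and of length `|γ| + 1`. -/
def treeSucc {α : Type*} (T : Set (List α)) (γ : List α) : Set (List α) :=
  {δ | δ ∈ T ∧ γ <+: δ ∧ δ.length = γ.length + 1}

/-- `T` is pruned if every node has a successor. -/
def IsPruned {α : Type*} (T : Set (List α)) : Prop :=
  ∀ γ ∈ T, (treeSucc T γ).Nonempty

/-- The finite prefix of length `n` of an infinite sequence `p`. -/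
def playPrefix {α : Type*} (p : ℕ → α) (n : ℕ) : List α :=
  List.ofFn fun i : Fin n => p i

/-- `[T]`: the infinite sequences all of whose finite prefixes lie in `T`. -/
def Body {α : Type*} (T : Set (List α)) : Set (ℕ → α) :=
  {p | ∀ n : ℕ, playPrefix p n ∈ T}

/-- `γ[T_γ]`: the elements of `[T]` extending the node `γ`. -/
def cylinder {α : Type*} (T : Set (List α)) (γ : List α) : Set (ℕ → α) :=
  {p | p ∈ Body T ∧ playPrefix p γ.length = γ}

/-- Open subsets of `[T]`: the unions of basic sets `γ[T_γ]`, `γ ∈ T`. -/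
def IsOpenIn {α : Type*} (T : Set (List α)) (A : Set (ℕ → α)) : Prop :=
  ∃ S ⊆ T, A = ⋃ γ ∈ S, cylinder T γ

/-- Closed subsets of `[T]`: complements in `[T]` of open subsets of `[T]`. -/
def IsClosedIn {α : Type*} (T : Set (List α)) (A : Set (ℕ → α)) : Prop :=
  A ⊆ Body T ∧ IsOpenIn T (Body T \ A)

/-- Borel subsets of `[T]`: members of the σ-algebra generated by the open
subsets of `[T]` that are themselves included in `[T]`. -/
def IsBorelIn {α : Type*} (T : Set (List α)) (X : Set (ℕ → α)) : Prop :=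
  X ⊆ Body T ∧
    @MeasurableSet (ℕ → α) (MeasurableSpace.generateFrom {A | IsOpenIn T A}) X

/-- `D_θ((A_η)_{η<θ})`: the set of `x ∈ ⋃_{η<θ} A_η` such that the least `η < θ`
with `x ∈ A_η` has parity opposite to that of `θ`. -/
noncomputable def Dset {α : Type*} (θ : Ordinal.{0}) (A : Ordinal.{0} → Set (ℕ → α)) :
    Set (ℕ → α) :=
  {x | (∃ η < θ, x ∈ A η) ∧ sInf {η | η < θ ∧ x ∈ A η} % 2 ≠ θ % 2}

/-- `D_θ([T])`: all sets of the form `D_θ((A_η)_{η<θ})` for an `⊆`-increasing family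
of open subsets of `[T]`. -/
def Dclass {α : Type*} (T : Set (List α)) (θ : Ordinal.{0}) : Set (Set (ℕ → α)) :=
  {X | ∃ A : Ordinal.{0} → Set (ℕ → α),
        (∀ η < θ, IsOpenIn T (A η)) ∧
        (∀ η₁ η₂, η₁ ≤ η₂ → η₂ < θ → A η₁ ⊆ A η₂) ∧
        X = Dset θ A}

/-- The quasi-difference sets `𝒟([T])`: open sets, unions of quasi-difference sets
placed below pairwise `⊑`-incomparable nodes, and complements in `[T]`. -/
inductive QuasiDiff {α : Type*} (T : Set (List α)) : Set (ℕ → α) → Prop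
  | isOpen : ∀ A, IsOpenIn T A → QuasiDiff T A
  | iUnion : ∀ (S : Set (List α)) (D : List α → Set (ℕ → α)),
      S ⊆ T → (S.Pairwise fun γ δ => ¬ γ <+: δ) →
      (∀ γ ∈ S, QuasiDiff T (D γ)) →
      (∀ γ ∈ S, D γ ⊆ cylinder T γ) →
      QuasiDiff T (⋃ γ ∈ S, D γ)
  | compl : ∀ A, QuasiDiff T A → QuasiDiff T (Body T \ A)

/-- An infinite game in extensive form: a tree `T` of finite plays, an owner function `d`,
an outcome function `v` on infinite plays, and a preference relation for each player. -/
structure Game (α A O : Type*) where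
  T : Set (List α)
  d : List α → A
  v : (ℕ → α) → O
  pref : A → O → O → Prop

/-- The infinite sequence starting with `γ` and continuing with `p`. -/
def listExtend {α : Type*} (γ : List α) (p : ℕ → α) : ℕ → α :=
  fun n => if h : n < γ.length then γ.get ⟨n, h⟩ else p (n - γ.length)

/-- The subgame `g_γ` of `g` at a node `γ`. -/
def Game.sub {α A O : Type*} (g : Game α A O) (γ : List α) : Game α A O where
  T := {δ | γ ++ δ ∈ g.T}
  d := fun δ => g.d (γ ++ δ)
  v := fun p => g.v (listExtend γ p)
  pref := g.pref

/-- A strategy profile on `T`: it maps each node of `T` to a successor. -/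
def IsProfile {α : Type*} (T : Set (List α)) (s : List α → List α) : Prop :=
  ∀ γ ∈ T, s γ ∈ treeSucc T γ

/-- The sequence of nodes obtained from `γ` by repeatedly applying `s`. -/
def iterNode {α : Type*} (s : List α → List α) (γ : List α) : ℕ → List α
  | 0 => γ
  | n + 1 => s (iterNode s γ n)

/-- The play `p^ε(s)` induced by `s` at the root. -/
def inducedPlay {α : Type*} [Inhabited α] (s : List α → List α) : ℕ → α :=
  fun n => (iterNode s [] (n + 1)).getD n default

/-- The subprofile `s_γ`, defined by `γ s_γ(δ) = s(γδ)`. -/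
def subProfile {α : Type*} (γ : List α) (s : List α → List α) : List α → List α :=
  fun δ => (s (γ ++ δ)).drop γ.length

/-- `s` is a Nash equilibrium of `g`: no player `a` has a profitable deviation `s'`
differing from `s` only at nodes owned by `a`. -/
def IsNE {α A O : Type*} [Inhabited α] (g : Game α A O) (s : List α → List α) : Prop :=
  ¬ ∃ (a : A) (s' : List α → List α), IsProfile g.T s' ∧
      (∀ γ ∈ g.T, s γ ≠ s' γ → g.d γ = a) ∧
      g.pref a (g.v (inducedPlay s)) (g.v (inducedPlay s'))

/-- `s` is a subgame perfect equilibrium of `g`: `s_γ` is an NE of `g_γ` for all `γ ∈ T`. -/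
def IsSPE {α A O : Type*} [Inhabited α] (g : Game α A O) (s : List α → List α) : Prop :=
  ∀ γ ∈ g.T, IsNE (g.sub γ) (subProfile γ s)

/-- The outcomes occurring in `g`. -/
def OutcomesOf {α A O : Type*} (g : Game α A O) : Set O := g.v '' Body g.T

/-- `x ∈ Os` is Pareto-optimal in `Os`. -/
def ParetoOpt {A O : Type*} (pref : A → O → O → Prop) (Os : Set O) (x : O) : Prop :=
  x ∈ Os ∧ ∀ y ∈ Os, ∀ a, pref a x y → ∃ b, pref b y x

/-- The outcome induced by the subprofile `s_γ` in the subgame `g_γ`. -/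
def subOutcome {α A O : Type*} [Inhabited α] (g : Game α A O) (s : List α → List α)
    (γ : List α) : O :=
  (g.sub γ).v (inducedPlay (subProfile γ s))

/-- Global-Pareto SPE: an SPE inducing in every subgame an outcome that is
Pareto-optimal among the outcomes occurring in that subgame. -/
def IsGPSPE {α A O : Type*} [Inhabited α] (g : Game α A O) (s : List α → List α) : Prop :=
  IsSPE g s ∧ ∀ γ ∈ g.T, ParetoOpt g.pref (OutcomesOf (g.sub γ)) (subOutcome g s γ)

/-- An `x`-pseudo-leaf: a shortest node `γ ∈ T` such that only `x` occurs in `g_γ`. -/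
def IsPseudoLeaf {α A O : Type*} (g : Game α A O) (x : O) (γ : List α) : Prop :=
  γ ∈ g.T ∧ OutcomesOf (g.sub γ) = {x} ∧
    ∀ δ, δ <+: γ → δ ≠ γ → OutcomesOf (g.sub δ) ≠ {x}

/-- A strict weak order: irreflexive, transitive, with transitive complement. -/
def IsSWO {O : Type*} (r : O → O → Prop) : Prop :=
  (∀ x, ¬ r x x) ∧ (∀ x y z, r x y → r y z → r x z) ∧
  (∀ x y z, ¬ r x y → ¬ r y z → ¬ r x z)

/-- The SPE killer does not occur in the family of preferences `lt`. -/
def NoSPEKiller {A O : Type*} (lt : A → O → O → Prop) : Prop :=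
  ∀ a b : A, ∀ x y z : O, ¬ (lt a z y ∧ lt a y x ∧ lt b x z ∧ lt b z y)

/-- The relation `≺_a` on `O = {x, y, z, t} = {0, 1, 2, 3}` with exactly the pairs
`z ≺_a x`, `z ≺_a y`, `t ≺_a x`, `t ≺_a y`. -/
def Ra : Fin 4 → Fin 4 → Prop := fun u v => (u = 2 ∨ u = 3) ∧ (v = 0 ∨ v = 1)

/-- The rank function of the strict linear order `y ≺_b z ≺_b x ≺_b t`
on `O = {x, y, z, t} = {0, 1, 2, 3}`. -/
def rankB : Fin 4 → ℕ := ![2, 0, 1, 3]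

/-- The strict linear order `y ≺_b z ≺_b x ≺_b t` on `O = {x, y, z, t} = {0, 1, 2, 3}`. -/
def Rb : Fin 4 → Fin 4 → Prop := fun u v => rankB u < rankB v

section Helpers

open Set

theorem pp_length {α : Type*} (p : ℕ → α) (n : ℕ) : (playPrefix p n).length = n := by
  simp [playPrefix]

theorem pp_take {α : Type*} (p : ℕ → α) {m n : ℕ} (h : m ≤ n) :
    (playPrefix p n).take m = playPrefix p m := by
  apply List.ext_getElem
  · simp [playPrefix, h]
  · intro i h1 h2
    simp [playPrefix]

theorem pp_prefix {α : Type*} (p : ℕ → α) {m n : ℕ} (h : m ≤ n) :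
    playPrefix p m <+: playPrefix p n := by
  rw [← pp_take p h]; exact List.take_prefix _ _

theorem pp_mono {α : Type*} {p q : ℕ → α} {m n : ℕ} (h : m ≤ n)
    (e : playPrefix p n = playPrefix q n) : playPrefix p m = playPrefix q m := by
  rw [← pp_take p h, ← pp_take q h, e]

theorem pp_of_prefix {α : Type*} {p : ℕ → α} {n : ℕ} {σ : List α}
    (h : σ <+: playPrefix p n) : playPrefix p σ.length = σ := by
  have hl : σ.length ≤ n := by simpa [pp_length] using h.length_le
  rw [← pp_take p hl]
  exact (List.prefix_iff_eq_take.1 h).symm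

theorem pp_succ {α : Type*} {T : Set (List α)} {p : ℕ → α} (hp : p ∈ Body T) (n : ℕ) :
    playPrefix p (n + 1) ∈ treeSucc T (playPrefix p n) :=
  ⟨hp _, pp_prefix p (Nat.le_succ n), by simp [pp_length]⟩

/-- Quasi-difference sets are locally trivial on every nonempty set of plays. -/
theorem qd_local {α : Type*} {T : Set (List α)} {A : Set (ℕ → α)} (h : QuasiDiff T A) :
    ∀ (F : Set (ℕ → α)), F ⊆ Body T → ∀ p ∈ F, ∀ n : ℕ, ∃ q ∈ F, ∃ m, n ≤ m ∧
      playPrefix q n = playPrefix p n ∧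
      ((∀ r ∈ F, playPrefix r m = playPrefix q m → r ∈ A) ∨
       (∀ r ∈ F, playPrefix r m = playPrefix q m → r ∉ A)) := by
  induction h with
  | isOpen A hA =>
    intro F hF p hp n
    obtain ⟨S, hS, rfl⟩ := hA
    by_cases hex : ∃ q ∈ F, playPrefix q n = playPrefix p n ∧ q ∈ ⋃ γ ∈ S, cylinder T γ
    · obtain ⟨q, hq, hqp, hqA⟩ := hex
      simp only [mem_iUnion] at hqA
      obtain ⟨σ, hσ, hqσ⟩ := hqA
      refine ⟨q, hq, max n σ.length, le_max_left _ _, hqp, Or.inl ?_⟩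
      intro r hr hrq
      simp only [mem_iUnion]
      refine ⟨σ, hσ, hF hr, ?_⟩
      rw [pp_mono (le_max_right _ _) hrq]; exact hqσ.2
    · push Not at hex
      exact ⟨p, hp, n, le_rfl, rfl, Or.inr fun r hr hrp => hex r hr hrp⟩
  | iUnion S D hS hpw hD hsub ih =>
    intro F hF p hp n
    by_cases hex : ∃ q ∈ F, playPrefix q n = playPrefix p n ∧ q ∈ ⋃ γ ∈ S, D γ
    · obtain ⟨q, hq, hqp, hqA⟩ := hex
      simp only [mem_iUnion] at hqA
      obtain ⟨σ, hσ, hqσ⟩ := hqA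
      have hσq := (hsub σ hσ hqσ).2
      obtain ⟨q', hq', m, hm, hqq, hor⟩ := ih σ hσ F hF q hq (max n σ.length)
      refine ⟨q', hq', m, (le_max_left _ _).trans hm,
        (pp_mono (le_max_left _ _) hqq).trans hqp, ?_⟩
      rcases hor with hor | hor
      · left
        intro r hr hrq
        simp only [mem_iUnion]
        exact ⟨σ, hσ, hor r hr hrq⟩
      · right
        intro r hr hrq hrA
        simp only [mem_iUnion] at hrA
        obtain ⟨σ', hσ', hr'⟩ := hrA
        have h1 : playPrefix r σ.length = σ := by
          rw [pp_mono ((le_max_right _ _).trans hm) hrq, pp_mono (le_max_right _ _) hqq, hσq]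
        have h2 := (hsub σ' hσ' hr').2
        have : σ' = σ := by
          by_contra hne
          rcases le_total σ.length σ'.length with hl | hl
          · have := pp_prefix r hl
            rw [h1, h2] at this
            exact hpw hσ hσ' (Ne.symm hne) this
          · have := pp_prefix r hl
            rw [h1, h2] at this
            exact hpw hσ' hσ hne this
        subst this
        exact hor r hr hrq hr'
    · push Not at hex
      exact ⟨p, hp, n, le_rfl, rfl, Or.inr fun r hr hrp => hex r hr hrp⟩
  | compl A hA ih =>
    intro F hF p hp n
    obtain ⟨q, hq, m, hm, hqp, hor⟩ := ih F hF p hp n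
    refine ⟨q, hq, m, hm, hqp, ?_⟩
    rcases hor with hor | hor
    · exact Or.inr fun r hr hrq h => h.2 (hor r hr hrq)
    · exact Or.inl fun r hr hrq => ⟨hF hr, hor r hr hrq⟩

/-- Hence the outcome function is locally constant somewhere on every nonempty set of plays. -/
theorem v_local {α : Type*} {T : Set (List α)} {v : (ℕ → α) → Fin 4}
    (hD : ∀ x : Fin 4, QuasiDiff T {p ∈ Body T | v p = x})
    (F : Set (ℕ → α)) (hF : F ⊆ Body T) (p : ℕ → α) (hp : p ∈ F) (n : ℕ) :
    ∃ q ∈ F, ∃ m, n ≤ m ∧ playPrefix q n = playPrefix p n ∧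
      ∀ r ∈ F, playPrefix r m = playPrefix q m → v r = v q := by
  have key : ∀ l : List (Fin 4), ∃ q ∈ F, ∃ m, n ≤ m ∧ playPrefix q n = playPrefix p n ∧
      ∀ x ∈ l, ((∀ r ∈ F, playPrefix r m = playPrefix q m → v r = x) ∨
       (∀ r ∈ F, playPrefix r m = playPrefix q m → v r ≠ x)) := by
    intro l
    induction l with
    | nil => exact ⟨p, hp, n, le_rfl, rfl, by simp⟩
    | cons x l ih =>
      obtain ⟨q, hq, m, hm, hqp, hl⟩ := ih
      obtain ⟨q', hq', m', hm', hqq, hor⟩ := qd_local (hD x) F hF q hq m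
      refine ⟨q', hq', m', hm.trans hm', (pp_mono hm hqq).trans hqp, ?_⟩
      intro y hy
      rcases List.mem_cons.1 hy with rfl | hy
      · rcases hor with hor | hor
        · exact Or.inl fun r hr e => (hor r hr e).2
        · exact Or.inr fun r hr e hv => hor r hr e ⟨hF hr, hv⟩
      · rcases hl y hy with h | h
        · exact Or.inl fun r hr e => h r hr ((pp_mono hm' e).trans hqq)
        · exact Or.inr fun r hr e => h r hr ((pp_mono hm' e).trans hqq)
  obtain ⟨q, hq, m, hm, hqp, hl⟩ := key [0, 1, 2, 3]
  refine ⟨q, hq, m, hm, hqp, ?_⟩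
  have hmem : v q ∈ [(0 : Fin 4), 1, 2, 3] := by
    generalize v q = u; revert u; decide
  rcases hl (v q) hmem with h | h
  · exact h
  · exact absurd rfl (h q hq rfl)

/-- A maximal partial function among those satisfying a chain-closed property. -/
theorem zorn_partial {N β : Type*} (Φ : Set N → (N → β) → Prop) (f0 : N → β)
    (hch : ∀ C : Set (Set N × (N → β)), (∀ c ∈ C, Φ c.1 c.2) → ∀ f : N → β,
      (∀ c ∈ C, EqOn f c.2 c.1) → Φ (⋃ c ∈ C, c.1) f) :
    ∃ S f, Φ S f ∧ ∀ S' f', Φ S' f' → S ⊆ S' → EqOn f' f S → S' ⊆ S := by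
  classical
  let r : {c : Set N × (N → β) // Φ c.1 c.2} → {c : Set N × (N → β) // Φ c.1 c.2} → Prop :=
    fun c c' => c.1.1 ⊆ c'.1.1 ∧ EqOn c'.1.2 c.1.2 c.1.1
  have hz : ∃ m, ∀ a, r m a → r a m := by
    apply exists_maximal_of_chains_bounded
    · intro C hC
      let C' : Set (Set N × (N → β)) := Subtype.val '' C
      let f : N → β := fun x => if h : ∃ c ∈ C', x ∈ c.1 then h.choose.2 x else f0 x
      have hf : ∀ c ∈ C', EqOn f c.2 c.1 := by
        intro c hc x hx
        have h : ∃ c ∈ C', x ∈ c.1 := ⟨c, hc, hx⟩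
        have hfx : f x = h.choose.2 x := dif_pos h
        rw [hfx]
        obtain ⟨h1, h2⟩ := h.choose_spec
        generalize h.choose = c' at h1 h2
        obtain ⟨d, hd, rfl⟩ := hc
        obtain ⟨d', hd', rfl⟩ := h1
        by_cases hdd : d = d'
        · rw [hdd]
        · rcases hC hd hd' hdd with hr | hr
          · exact hr.2 hx
          · exact (hr.2 h2).symm
      refine ⟨⟨(⋃ c ∈ C', c.1, f), hch C' ?_ f hf⟩, ?_⟩
      · rintro c ⟨d, hd, rfl⟩; exact d.2
      · intro a ha
        have ha' : a.1 ∈ C' := ⟨a, ha, rfl⟩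
        exact ⟨subset_biUnion_of_mem (u := fun c : Set N × (N → β) => c.1) ha', hf _ ha'⟩
    · intro a b c hab hbc
      exact ⟨hab.1.trans hbc.1, fun x hx => (hbc.2 (hab.1 hx)).trans (hab.2 hx)⟩
  obtain ⟨m, hm⟩ := hz
  refine ⟨m.1.1, m.1.2, m.2, fun S' f' h hS hf => ?_⟩
  exact (hm ⟨(S', f'), h⟩ ⟨hS, hf⟩).1

/-- The preferences of the two players. -/
def pr : Bool → Fin 4 → Fin 4 → Prop
  | true => Ra
  | false => Rb

instance (u w : Fin 4) : Decidable (Ra u w) := by unfold Ra; infer_instance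
instance (u w : Fin 4) : Decidable (Rb u w) := by unfold Rb; infer_instance
instance (c : Bool) (u w : Fin 4) : Decidable (pr c u w) := by
  cases c <;> (unfold pr; infer_instance)

theorem pr_irrefl : ∀ c u, ¬ pr c u u := by decide
theorem pr_negtrans : ∀ c u w k, ¬ pr c u w → ¬ pr c w k → ¬ pr c u k := by decide

/-- `p` is a play through `γ` following `f` at the nodes of `S` satisfying `P`. -/
def Cmp {α β : Type*} (T S : Set (List α)) (f : List α → List α × β) (P : List α → Prop)
    (γ : List α) (p : ℕ → α) : Prop :=
  p ∈ Body T ∧ playPrefix p γ.length = γ ∧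
    ∀ n, γ.length ≤ n → playPrefix p n ∈ S → P (playPrefix p n) →
      playPrefix p (n + 1) = (f (playPrefix p n)).1

theorem Cmp.mono {α β : Type*} {T S S' : Set (List α)} {f f' : List α → List α × β}
    {P : List α → Prop} {γ : List α} {p : ℕ → α} (hS : S ⊆ S') (hf : EqOn f' f S)
    (h : Cmp T S' f' P γ p) : Cmp T S f P γ p :=
  ⟨h.1, h.2.1, fun n hn hs hP => by rw [h.2.2 n hn (hS hs) hP, hf hs]⟩

theorem Cmp.pass {α β : Type*} {T S : Set (List α)} {f : List α → List α × β}
    {P : List α → Prop} {γ : List α} {p : ℕ → α} (h : Cmp T S f P γ p) {n : ℕ}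
    (hn : γ.length ≤ n) : Cmp T S f P (playPrefix p n) p :=
  ⟨h.1, by rw [pp_length], fun m hm hs hP => h.2.2 m (by rw [pp_length] at hm; omega) hs hP⟩

/-- A robust partial solution of the game on the set of nodes `S`. -/
structure Sol {α : Type*} (g : Game α Bool (Fin 4)) (S : Set (List α))
    (f : List α → List α × Fin 4) : Prop where
  sub : S ⊆ g.T
  cl : ∀ γ ∈ S, (f γ).1 ∈ treeSucc g.T γ
  val : ∀ γ ∈ S, ∀ p, Cmp g.T S f (fun _ => True) γ p → g.v p = (f γ).2
  rob : ∀ γ ∈ S, ∀ c p, Cmp g.T S f (fun δ => g.d δ ≠ c) γ p → ¬ pr c (f γ).2 (g.v p)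

theorem Sol.exists_max {α : Type*} (g : Game α Bool (Fin 4)) :
    ∃ S f, Sol g S f ∧ ∀ S' f', Sol g S' f' → S ⊆ S' → EqOn f' f S → S' ⊆ S := by
  apply zorn_partial (Sol g) (fun γ => (γ, 0))
  intro C hC f hf
  have hsub : ∀ c ∈ C, c.1 ⊆ ⋃ c ∈ C, c.1 := fun c hc =>
    subset_biUnion_of_mem (u := fun c : Set (List α) × (List α → List α × Fin 4) => c.1) hc
  constructor
  · intro γ hγ
    simp only [mem_iUnion] at hγ
    obtain ⟨c, hc, hγ⟩ := hγ
    exact (hC c hc).sub hγ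
  · intro γ hγ
    simp only [mem_iUnion] at hγ
    obtain ⟨c, hc, hγ⟩ := hγ
    rw [hf c hc hγ]
    exact (hC c hc).cl γ hγ
  · intro γ hγ p hp
    simp only [mem_iUnion] at hγ
    obtain ⟨c, hc, hγ⟩ := hγ
    rw [hf c hc hγ]
    exact (hC c hc).val γ hγ p (hp.mono (hsub c hc) (hf c hc))
  · intro γ hγ k p hp
    simp only [mem_iUnion] at hγ
    obtain ⟨c, hc, hγ⟩ := hγ
    rw [hf c hc hγ]
    exact (hC c hc).rob γ hγ k p (hp.mono (hsub c hc) (hf c hc))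

/-- Extending a solution: only the new nodes have to be checked. -/
theorem Sol.extend {α : Type*} {g : Game α Bool (Fin 4)} {S E : Set (List α)}
    {f f' : List α → List α × Fin 4} (h : Sol g S f) (hE : E ⊆ g.T) (hf : EqOn f' f S)
    (cl : ∀ γ ∈ E, (f' γ).1 ∈ treeSucc g.T γ)
    (val : ∀ γ ∈ E, ∀ p, Cmp g.T (S ∪ E) f' (fun _ => True) γ p → g.v p = (f' γ).2)
    (rob : ∀ γ ∈ E, ∀ c p, Cmp g.T (S ∪ E) f' (fun δ => g.d δ ≠ c) γ p →
      ¬ pr c (f' γ).2 (g.v p)) : Sol g (S ∪ E) f' := by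
  constructor
  · exact union_subset h.sub hE
  · rintro γ (hγ | hγ)
    · rw [hf hγ]; exact h.cl γ hγ
    · exact cl γ hγ
  · rintro γ (hγ | hγ) p hp
    · rw [hf hγ]; exact h.val γ hγ p (hp.mono subset_union_left hf)
    · exact val γ hγ p hp
  · rintro γ (hγ | hγ) c p hp
    · rw [hf hγ]; exact h.rob γ hγ c p (hp.mono subset_union_left hf)
    · exact rob γ hγ c p hp

/-- One-node extension. -/
theorem Sol.one {α : Type*} {g : Game α Bool (Fin 4)} {S : Set (List α)}
    {f : List α → List α × Fin 4} (h : Sol g S f) {γ γ' : List α} (hγ : γ ∈ g.T)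
    (hγS : γ ∉ S) (hγ' : γ' ∈ S) (hs : γ' ∈ treeSucc g.T γ)
    (hall : ∀ e ∈ treeSucc g.T γ, (∀ u, ¬ pr (g.d γ) (f γ').2 u) ∨
      (e ∈ S ∧ ¬ pr (g.d γ) (f γ').2 (f e).2)) :
    ∃ f', Sol g (S ∪ {γ}) f' ∧ EqOn f' f S := by
  classical
  have hf : EqOn (Function.update f γ (γ', (f γ').2)) f S := by
    intro δ hδ
    exact Function.update_of_ne (by rintro rfl; exact hγS hδ) _ _
  refine ⟨_, h.extend (by simpa using hγ) hf ?_ ?_ ?_, hf⟩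
  · rintro δ rfl; simpa using hs
  · rintro δ rfl p hp
    have h1 := hp.2.2 δ.length le_rfl (by rw [hp.2.1]; simp) trivial
    have h2 := (hp.pass (Nat.le_succ _)).mono subset_union_left hf
    rw [hp.2.1, Function.update_self] at h1
    rw [h1] at h2
    rw [Function.update_self]
    exact h.val γ' hγ' p h2
  · rintro δ rfl c p hp
    have h2 := (hp.pass (Nat.le_succ _)).mono subset_union_left hf
    rw [Function.update_self]
    by_cases hc : g.d δ = c
    · have h3 := pp_succ hp.1 δ.length
      rw [hp.2.1] at h3
      subst hc
      rcases hall _ h3 with h4 | ⟨h4, h5⟩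
      · exact h4 _
      · exact pr_negtrans _ _ _ _ h5 (h.rob _ h4 _ p h2)
    · have h1 := hp.2.2 δ.length le_rfl (by rw [hp.2.1]; simp) (by rw [hp.2.1]; exact hc)
      rw [hp.2.1, Function.update_self] at h1
      rw [h1] at h2
      exact h.rob γ' hγ' c p h2

/-- The region `E` of unsolved nodes where staying forever has the constant outcome `c`. -/
structure Region {α : Type*} (g : Game α Bool (Fin 4)) (S : Set (List α))
    (f : List α → List α × Fin 4) (E : Set (List α)) (c : Fin 4) : Prop where
  subT : E ⊆ g.T
  disj : ∀ δ ∈ E, δ ∉ S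
  succ : ∀ δ ∈ E, ∀ e ∈ treeSucc g.T δ, e ∈ E ∨ e ∈ S
  stay : ∀ δ ∈ E, ∃ e ∈ treeSucc g.T δ, e ∈ E
  const : ∀ p ∈ Body g.T, ∀ m, (∀ n, m ≤ n → playPrefix p n ∈ E) → g.v p = c
  exA : ∀ δ ∈ E, g.d δ = true → ∀ e ∈ treeSucc g.T δ, e ∈ S → (f e).2 = 2 ∨ (f e).2 = 3
  exB : ∀ δ ∈ E, g.d δ = false → ∀ e ∈ treeSucc g.T δ, e ∈ S → (f e).2 ≠ 3

theorem Region.exit {α : Type*} {g : Game α Bool (Fin 4)} {S : Set (List α)}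
    {f : List α → List α × Fin 4} {E : Set (List α)} {c : Fin 4} (R : Region g S f E c)
    {δ : List α} (hδ : δ ∈ E) {p : ℕ → α} (hp : p ∈ Body g.T)
    (he : playPrefix p δ.length = δ) :
    (∀ n, δ.length ≤ n → playPrefix p n ∈ E) ∨
    ∃ n, δ.length ≤ n ∧ (∀ m, δ.length ≤ m → m ≤ n → playPrefix p m ∈ E) ∧
      playPrefix p (n + 1) ∈ S := by
  classical
  by_cases h : ∃ n, δ.length ≤ n ∧ playPrefix p n ∉ E
  · right
    obtain ⟨h1, h2⟩ := Nat.find_spec h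
    have hmin : ∀ m, m < Nat.find h → δ.length ≤ m → playPrefix p m ∈ E := by
      intro m hm hl
      have := Nat.find_min h hm
      push Not at this
      exact this hl
    generalize Nat.find h = k at *
    have hk : δ.length ≠ k := by
      rintro rfl; exact h2 (by rw [he]; exact hδ)
    obtain ⟨n, rfl⟩ : ∃ n, k = n + 1 := ⟨k - 1, by omega⟩
    refine ⟨n, by omega, fun m hm hmn => hmin m (by omega) hm, ?_⟩
    rcases R.succ _ (hmin n (by omega) (by omega)) _ (pp_succ hp n) with h3 | h3
    · exact absurd h3 h2
    · exact h3
  · left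
    push Not at h
    exact h

/-- Solving a whole region with strategy `k` and outcomes `o`. -/
theorem Region.solve {α : Type*} {g : Game α Bool (Fin 4)} {S : Set (List α)}
    {f : List α → List α × Fin 4} {E : Set (List α)} {c : Fin 4} (R : Region g S f E c)
    (h : Sol g S f) (k : List α → List α × Fin 4)
    (hk : ∀ δ ∈ E, (k δ).1 ∈ treeSucc g.T δ)
    (hT1 : ∀ δ ∈ E, ∀ p, Cmp g.T E k (fun _ => True) δ p →
      (∀ n, δ.length ≤ n → playPrefix p n ∈ E) → c = (k δ).2)
    (hT2 : ∀ δ ∈ E, ∀ p, Cmp g.T E k (fun _ => True) δ p → ∀ n, δ.length ≤ n →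
      (∀ m, δ.length ≤ m → m ≤ n → playPrefix p m ∈ E) → playPrefix p (n + 1) ∈ S →
      (f (playPrefix p (n + 1))).2 = (k δ).2)
    (hC1 : ∀ δ ∈ E, ∀ a p, Cmp g.T E k (fun δ => g.d δ ≠ a) δ p →
      (∀ n, δ.length ≤ n → playPrefix p n ∈ E) → ¬ pr a (k δ).2 c)
    (hC2 : ∀ δ ∈ E, ∀ a p, Cmp g.T E k (fun δ => g.d δ ≠ a) δ p → ∀ n, δ.length ≤ n →
      (∀ m, δ.length ≤ m → m ≤ n → playPrefix p m ∈ E) → playPrefix p (n + 1) ∈ S →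
      ¬ pr a (k δ).2 (f (playPrefix p (n + 1))).2) :
    ∃ f', Sol g (S ∪ E) f' ∧ EqOn f' f S := by
  classical
  let f' : List α → List α × Fin 4 := fun δ => if δ ∈ E then k δ else f δ
  have hf : EqOn f' f S := fun δ hδ => if_neg fun hE => R.disj δ hE hδ
  have hfE : EqOn f' k E := fun δ hδ => if_pos hδ
  refine ⟨f', h.extend R.subT hf ?_ ?_ ?_, hf⟩
  · intro δ hδ; rw [hfE hδ]; exact hk δ hδ
  · intro δ hδ p hp
    rw [hfE hδ]
    have hp' := hp.mono subset_union_right hfE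
    rcases R.exit hδ hp.1 hp.2.1 with h1 | ⟨n, hn, h1, h2⟩
    · rw [R.const p hp.1 _ h1]; exact hT1 δ hδ p hp' h1
    · rw [← hT2 δ hδ p hp' n hn h1 h2]
      exact h.val _ h2 p ((hp.pass (by omega)).mono subset_union_left hf)
  · intro δ hδ a p hp
    rw [hfE hδ]
    have hp' := hp.mono subset_union_right hfE
    rcases R.exit hδ hp.1 hp.2.1 with h1 | ⟨n, hn, h1, h2⟩
    · rw [R.const p hp.1 _ h1]; exact hC1 δ hδ a p hp' h1
    · exact pr_negtrans _ _ _ _ (hC2 δ hδ a p hp' n hn h1 h2)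
        (h.rob _ h2 a p ((hp.pass (by omega)).mono subset_union_left hf))

theorem Region.solve_stay {α : Type*} {g : Game α Bool (Fin 4)} {S : Set (List α)}
    {f : List α → List α × Fin 4} {E : Set (List α)} {c : Fin 4} (R : Region g S f E c)
    (h : Sol g S f)
    (hex : ∀ δ ∈ E, ∀ e ∈ treeSucc g.T δ, e ∈ S → ¬ pr (g.d δ) c (f e).2) :
    ∃ f', Sol g (S ∪ E) f' ∧ EqOn f' f S := by
  classical
  have hst : ∀ δ, ∃ e, δ ∈ E → e ∈ treeSucc g.T δ ∧ e ∈ E := by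
    intro δ
    by_cases hδ : δ ∈ E
    · obtain ⟨e, h1, h2⟩ := R.stay δ hδ
      exact ⟨e, fun _ => ⟨h1, h2⟩⟩
    · exact ⟨δ, fun h => absurd h hδ⟩
  choose st hst using hst
  refine R.solve h (fun δ => (st δ, c)) (fun δ hδ => (hst δ hδ).1) (fun _ _ _ _ _ => rfl) ?_
    (fun _ _ _ _ _ _ => pr_irrefl _ _) ?_
  · intro δ hδ p hp n hn hE hS
    exfalso
    have h1 : playPrefix p (n + 1) = st (playPrefix p n) :=
      hp.2.2 n hn (hE n hn le_rfl) trivial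
    exact R.disj _ (hst _ (hE n hn le_rfl)).2 (h1 ▸ hS)
  · intro δ hδ a p hp n hn hE hS
    by_cases ha : g.d (playPrefix p n) = a
    · subst ha
      exact hex _ (hE n hn le_rfl) _ (pp_succ hp.1 n) hS
    · exfalso
      have h1 : playPrefix p (n + 1) = st (playPrefix p n) :=
        hp.2.2 n hn (hE n hn le_rfl) ha
      exact R.disj _ (hst _ (hE n hn le_rfl)).2 (h1 ▸ hS)

/-- Within `E`, a `b`-owned node with an exit of outcome `x` is reachable in `n` steps. -/
def XR {α : Type*} (g : Game α Bool (Fin 4)) (S : Set (List α))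
    (f : List α → List α × Fin 4) (E : Set (List α)) : ℕ → List α → Prop
  | 0, δ => g.d δ = false ∧ ∃ e ∈ treeSucc g.T δ, e ∈ S ∧ (f e).2 = 0
  | n + 1, δ => ∃ e ∈ treeSucc g.T δ, e ∈ E ∧ XR g S f E n e

theorem Region.solve_x {α : Type*} {g : Game α Bool (Fin 4)} {S : Set (List α)}
    {f : List α → List α × Fin 4} {E : Set (List α)} {c : Fin 4} (R : Region g S f E c)
    (h : Sol g S f) (hc : c ≠ 3) (hx : ∀ δ ∈ E, ∃ n, XR g S f E n δ) :
    ∃ f', Sol g (S ∪ E) f' ∧ EqOn f' f S := by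
  classical
  let r : List α → ℕ := fun δ => sInf {n | XR g S f E n δ}
  have hr : ∀ δ ∈ E, XR g S f E (r δ) δ := fun δ hδ => Nat.sInf_mem (hx δ hδ)
  have hst : ∀ δ, ∃ e, δ ∈ E → e ∈ treeSucc g.T δ ∧
      ((g.d δ = false ∧ e ∈ S ∧ (f e).2 = 0) ∨ (e ∈ E ∧ r e < r δ)) := by
    intro δ
    by_cases hδ : δ ∈ E
    · have h1 := hr δ hδ
      cases hn : r δ with
      | zero =>
        rw [hn] at h1
        obtain ⟨h2, e, h3, h4, h5⟩ := h1
        exact ⟨e, fun _ => ⟨h3, Or.inl ⟨h2, h4, h5⟩⟩⟩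
      | succ n =>
        rw [hn] at h1
        obtain ⟨e, h3, h4, h5⟩ := h1
        have : r e ≤ n := Nat.sInf_le h5
        exact ⟨e, fun _ => ⟨h3, Or.inr ⟨h4, by omega⟩⟩⟩
    · exact ⟨δ, fun h => absurd h hδ⟩
  choose st hst using hst
  refine R.solve h (fun δ => (st δ, 0)) (fun δ hδ => (hst δ hδ).1) ?_ ?_ ?_ ?_
  · intro δ hδ p hp hE
    exfalso
    have key : ∀ n, r (playPrefix p (δ.length + n)) + n ≤ r (playPrefix p δ.length) := by
      intro n
      induction n with
      | zero => simp
      | succ n ih =>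
        have hl : δ.length ≤ δ.length + n := by omega
        have h1 : playPrefix p (δ.length + n + 1) = st (playPrefix p (δ.length + n)) :=
          hp.2.2 _ hl (hE _ hl) trivial
        rcases (hst _ (hE _ hl)).2 with h2 | h2
        · exact absurd (h1 ▸ h2.2.1) (R.disj _ (hE _ (by omega)))
        · rw [← h1] at h2
          have h3 : r (playPrefix p (δ.length + (n + 1))) < r (playPrefix p (δ.length + n)) := h2.2
          omega
    have := key (r (playPrefix p δ.length) + 1)
    omega
  · intro δ hδ p hp n hn hE hS
    have h1 : playPrefix p (n + 1) = st (playPrefix p n) :=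
      hp.2.2 n hn (hE n hn le_rfl) trivial
    rcases (hst _ (hE n hn le_rfl)).2 with h2 | h2
    · rw [h1]; exact h2.2.2
    · exact absurd (h1 ▸ hS) (R.disj _ h2.1)
  · intro δ hδ a p hp hE
    exact (by decide : ∀ (a : Bool) (c : Fin 4), c ≠ 3 → ¬ pr a 0 c) a c hc
  · intro δ hδ a p hp n hn hE hS
    cases a with
    | true => exact (by decide : ∀ u, ¬ pr true 0 u) _
    | false =>
      refine (by decide : ∀ u, u ≠ 3 → ¬ pr false 0 u) _ ?_
      by_cases ha : g.d (playPrefix p n) = false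
      · exact R.exB _ (hE n hn le_rfl) ha _ (pp_succ hp.1 n) hS
      · have h1 : playPrefix p (n + 1) = st (playPrefix p n) :=
          hp.2.2 n hn (hE n hn le_rfl) ha
        rcases (hst _ (hE n hn le_rfl)).2 with h2 | h2
        · exact absurd h2.1 ha
        · exact absurd (h1 ▸ hS) (R.disj _ h2.1)

/-- `Z` is a set of nodes of `E` from which player `b`, using `k`, forces the play to
leave `E`, with `b` only leaving to outcome `z`. -/
def Att {α : Type*} (g : Game α Bool (Fin 4)) (S : Set (List α))
    (f : List α → List α × Fin 4) (E : Set (List α)) (Z : Set (List α))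
    (k : List α → List α × Unit) : Prop :=
  ∀ δ ∈ Z, δ ∈ E ∧
    (g.d δ = false → (k δ).1 ∈ treeSucc g.T δ ∧
      ((k δ).1 ∈ Z ∨ ((k δ).1 ∈ S ∧ (f (k δ).1).2 = 2))) ∧
    (g.d δ = true → ∀ e ∈ treeSucc g.T δ, e ∈ E → e ∈ Z) ∧
    ∀ p, Cmp g.T Z k (fun δ => g.d δ = false) δ p → ¬ ∀ n, δ.length ≤ n → playPrefix p n ∈ E

theorem Att.exists_max {α : Type*} (g : Game α Bool (Fin 4)) (S : Set (List α))
    (f : List α → List α × Fin 4) (E : Set (List α)) :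
    ∃ Z k, Att g S f E Z k ∧
      ∀ Z' k', Att g S f E Z' k' → Z ⊆ Z' → EqOn k' k Z → Z' ⊆ Z := by
  apply zorn_partial (Att g S f E) (fun γ => (γ, ()))
  intro C hC k hk δ hδ
  have hsub : ∀ c ∈ C, c.1 ⊆ ⋃ c ∈ C, c.1 := fun c hc =>
    subset_biUnion_of_mem (u := fun c : Set (List α) × (List α → List α × Unit) => c.1) hc
  simp only [mem_iUnion] at hδ
  obtain ⟨c, hc, hδ⟩ := hδ
  obtain ⟨h1, h2, h3, h4⟩ := hC c hc δ hδ
  rw [hk c hc hδ]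
  refine ⟨h1, fun hd => ⟨(h2 hd).1, (h2 hd).2.imp_left fun h => hsub c hc h⟩,
    fun hd e he hE => hsub c hc (h3 hd e he hE), fun p hp => h4 p (hp.mono (hsub c hc) (hk c hc))⟩

theorem Att.one {α : Type*} {g : Game α Bool (Fin 4)} {S : Set (List α)}
    {f : List α → List α × Fin 4} {E Z : Set (List α)} {k : List α → List α × Unit}
    (h : Att g S f E Z k)
    (hmax : ∀ Z' k', Att g S f E Z' k' → Z ⊆ Z' → EqOn k' k Z → Z' ⊆ Z)
    (hdisj : ∀ δ ∈ E, δ ∉ S)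
    {γ e : List α} (hγ : γ ∈ E)
    (hb : g.d γ = false → e ∈ treeSucc g.T γ ∧ (e ∈ Z ∨ (e ∈ S ∧ (f e).2 = 2)))
    (ha : g.d γ = true → ∀ e ∈ treeSucc g.T γ, e ∈ E → e ∈ Z) : γ ∈ Z := by
  classical
  by_contra hγZ
  have hk : EqOn (Function.update k γ (e, ())) k Z := by
    intro δ hδ
    exact Function.update_of_ne (by rintro rfl; exact hγZ hδ) _ _
  refine hγZ (hmax (Z ∪ {γ}) _ ?_ subset_union_left hk (Or.inr rfl))
  rintro δ (hδ | rfl)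
  · obtain ⟨h1, h2, h3, h4⟩ := h δ hδ
    rw [hk hδ]
    exact ⟨h1, fun hd => ⟨(h2 hd).1, (h2 hd).2.imp_left Or.inl⟩,
      fun hd e he hE => Or.inl (h3 hd e he hE), fun p hp => h4 p (hp.mono subset_union_left hk)⟩
  · rw [Function.update_self]
    refine ⟨hγ, fun hd => ⟨(hb hd).1, (hb hd).2.imp_left Or.inl⟩,
      fun hd e he hE => Or.inl (ha hd e he hE), fun p hp hE => ?_⟩
    have hp' := (hp.pass (Nat.le_succ _)).mono subset_union_left hk
    have hnZ : playPrefix p (δ.length + 1) ∉ Z := by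
      intro hZ
      refine (h _ hZ).2.2.2 p hp' fun n hn => hE n ?_
      rw [pp_length] at hn; omega
    have hs := pp_succ hp.1 δ.length
    rw [hp.2.1] at hs
    have hE1 := hE (δ.length + 1) (by omega)
    cases hd : g.d δ with
    | true => exact hnZ (ha hd _ hs hE1)
    | false =>
      have h1 := hp.2.2 δ.length le_rfl (by rw [hp.2.1]; simp) (by rw [hp.2.1]; exact hd)
      rw [hp.2.1, Function.update_self] at h1
      rcases (hb hd).2 with h2 | h2
      · exact hnZ (h1 ▸ h2)
      · exact hdisj _ hE1 (h1 ▸ h2.1)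

theorem Region.solve_y {α : Type*} {g : Game α Bool (Fin 4)} {S : Set (List α)}
    {f : List α → List α × Fin 4} {E : Set (List α)} (R : Region g S f E 1)
    (h : Sol g S f)
    (hx : ∀ δ ∈ E, g.d δ = false → ∀ e ∈ treeSucc g.T δ, e ∈ S → (f e).2 ≠ 0) :
    ∃ f', Sol g (S ∪ E) f' ∧ EqOn f' f S := by
  classical
  obtain ⟨Z, k, hZ, hmax⟩ := Att.exists_max g S f E
  have hst : ∀ δ, ∃ e, δ ∈ E → e ∈ treeSucc g.T δ ∧
      (g.d δ = true → e ∈ E) ∧ (δ ∉ Z → e ∈ E ∧ e ∉ Z) ∧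
      (δ ∈ Z → g.d δ = false → e = (k δ).1) := by
    intro δ
    by_cases hδ : δ ∈ E
    · obtain ⟨e, h1, h2⟩ := R.stay δ hδ
      cases hd : g.d δ with
      | true =>
        by_cases hδZ : δ ∈ Z
        · exact ⟨e, fun _ => ⟨h1, fun _ => h2, fun h => absurd hδZ h, by simp⟩⟩
        · have : ∃ e ∈ treeSucc g.T δ, e ∈ E ∧ e ∉ Z := by
            by_contra hcon
            push Not at hcon
            exact hδZ (hZ.one hmax R.disj (e := e) hδ (by simp [hd]) fun _ => hcon)
          obtain ⟨e', h1', h2', h3'⟩ := this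
          exact ⟨e', fun _ => ⟨h1', fun _ => h2', fun _ => ⟨h2', h3'⟩, by simp⟩⟩
      | false =>
        by_cases hδZ : δ ∈ Z
        · exact ⟨(k δ).1, fun _ => ⟨((hZ δ hδZ).2.1 hd).1, by simp, fun h => absurd hδZ h,
            by simp⟩⟩
        · refine ⟨e, fun _ => ⟨h1, by simp, fun _ => ⟨h2, fun heZ => hδZ ?_⟩,
            fun h => absurd h hδZ⟩⟩
          exact hZ.one hmax R.disj (e := e) hδ (fun _ => ⟨h1, Or.inl heZ⟩) (by simp [hd])
    · exact ⟨δ, fun h => absurd h hδ⟩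
  choose st hst using hst
  have hbZ : ∀ δ ∈ E, δ ∉ Z → g.d δ = false → ∀ e ∈ treeSucc g.T δ,
      e ∉ Z ∧ (e ∈ S → (f e).2 ≠ 2) := by
    intro δ hδ hδZ hd e he
    refine ⟨fun heZ => hδZ ?_, fun heS he2 => hδZ ?_⟩
    · exact hZ.one hmax R.disj (e := e) hδ (fun _ => ⟨he, Or.inl heZ⟩) (by simp [hd])
    · exact hZ.one hmax R.disj (e := e) hδ (fun _ => ⟨he, Or.inr ⟨heS, he2⟩⟩) (by simp [hd])
  let K : List α → List α × Fin 4 := fun δ => (st δ, if δ ∈ Z then 2 else 1)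
  have K2 : ∀ δ ∈ Z, (K δ).2 = 2 := fun δ hδ => if_pos hδ
  have K1 : ∀ δ, δ ∉ Z → (K δ).2 = 1 := fun δ hδ => if_neg hδ
  -- plays following `b` in `Z` remain in `Z` as long as they stay in `E`
  have inZ : ∀ δ ∈ Z, ∀ P : List α → Prop, (∀ δ, g.d δ = false → P δ) → ∀ p,
      Cmp g.T E K P δ p → ∀ n, (∀ m, δ.length ≤ m → m ≤ δ.length + n → playPrefix p m ∈ E) →
      playPrefix p (δ.length + n) ∈ Z := by
    intro δ hδ P hP p hp n
    induction n with
    | zero => intro _; rw [add_zero, hp.2.1]; exact hδ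
    | succ n ih =>
      intro hE
      have hn := ih fun m h1 h2 => hE m h1 (by omega)
      have hE1 := hE (δ.length + n + 1) (by omega) (by omega)
      rw [← add_assoc]
      cases hd : g.d (playPrefix p (δ.length + n)) with
      | true => exact (hZ _ hn).2.2.1 hd _ (pp_succ hp.1 _) hE1
      | false =>
        have hEn := hE (δ.length + n) (by omega) (by omega)
        have h1 : playPrefix p (δ.length + n + 1) = st (playPrefix p (δ.length + n)) :=
          hp.2.2 _ (by omega) hEn (hP _ hd)
        rw [(hst _ hEn).2.2.2 hn hd] at h1
        rcases ((hZ _ hn).2.1 hd).2 with h2 | h2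
        · rw [h1]; exact h2
        · exact absurd (h1 ▸ h2.1) (R.disj _ hE1)
  have outZ : ∀ δ ∈ E, δ ∉ Z → ∀ P : List α → Prop, (∀ δ, g.d δ = true → P δ) → ∀ p,
      Cmp g.T E K P δ p → ∀ n, (∀ m, δ.length ≤ m → m ≤ δ.length + n → playPrefix p m ∈ E) →
      playPrefix p (δ.length + n) ∉ Z := by
    intro δ hδE hδ P hP p hp n
    induction n with
    | zero => intro _; rw [add_zero, hp.2.1]; exact hδ
    | succ n ih =>
      intro hE
      have hn := ih fun m h1 h2 => hE m h1 (by omega)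
      have hEn := hE (δ.length + n) (by omega) (by omega)
      rw [← add_assoc]
      cases hd : g.d (playPrefix p (δ.length + n)) with
      | false => exact (hbZ _ hEn hn hd _ (pp_succ hp.1 _)).1
      | true =>
        have h1 : playPrefix p (δ.length + n + 1) = st (playPrefix p (δ.length + n)) :=
          hp.2.2 _ (by omega) hEn (hP _ hd)
        rw [h1]
        exact ((hst _ hEn).2.2.1 hn).2
  have noStay : ∀ δ ∈ Z, ∀ P : List α → Prop, (∀ δ, g.d δ = false → P δ) → ∀ p,
      Cmp g.T E K P δ p → ¬ ∀ n, δ.length ≤ n → playPrefix p n ∈ E := by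
    intro δ hδ P hP p hp hE
    refine (hZ δ hδ).2.2.2 p ⟨hp.1, hp.2.1, fun n hn hnZ hd => ?_⟩ hE
    rw [hp.2.2 n hn (hE n hn) (hP _ hd)]
    exact (hst _ (hE n hn)).2.2.2 hnZ hd
  -- exits at a `b`-node of `Z` following the strategy have outcome `z`
  have exZ : ∀ δ ∈ Z, g.d δ = false → st δ ∈ S → (f (st δ)).2 = 2 := by
    intro δ hδ hd hS
    rw [(hst δ (hZ δ hδ).1).2.2.2 hδ hd] at hS ⊢
    rcases ((hZ δ hδ).2.1 hd).2 with h2 | h2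
    · exact absurd hS (R.disj _ (hZ _ h2).1)
    · exact h2.2
  refine R.solve h K (fun δ hδ => (hst δ hδ).1) ?_ ?_ ?_ ?_
  · intro δ hδ p hp hE
    by_cases hδZ : δ ∈ Z
    · exact absurd hE (noStay δ hδZ _ (fun _ _ => trivial) p hp)
    · exact (K1 δ hδZ).symm
  · intro δ hδ p hp n hn hE hS
    obtain ⟨j, rfl⟩ := Nat.exists_eq_add_of_le hn
    have hEn := hE _ hn le_rfl
    have h1 : playPrefix p (δ.length + j + 1) = st (playPrefix p (δ.length + j)) :=
      hp.2.2 _ hn hEn trivial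
    by_cases hδZ : δ ∈ Z
    · have hnZ := inZ δ hδZ _ (fun _ _ => trivial) p hp j hE
      rw [K2 δ hδZ, h1]
      cases hd : g.d (playPrefix p (δ.length + j)) with
      | true => exact absurd (h1 ▸ hS) (R.disj _ ((hst _ hEn).2.1 hd))
      | false => exact exZ _ hnZ hd (h1 ▸ hS)
    · have hnZ := outZ δ hδ hδZ _ (fun _ _ => trivial) p hp j hE
      exact absurd (h1 ▸ hS) (R.disj _ ((hst _ hEn).2.2.1 hnZ).1)
  · intro δ hδ a p hp hE
    by_cases hδZ : δ ∈ Z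
    · cases a with
      | true => exact absurd hE (noStay δ hδZ _ (fun δ hd => by simp [hd]) p hp)
      | false => rw [K2 δ hδZ]; decide
    · rw [K1 δ hδZ]; exact pr_irrefl _ _
  · intro δ hδ a p hp n hn hE hS
    obtain ⟨j, rfl⟩ := Nat.exists_eq_add_of_le hn
    have hEn := hE _ hn le_rfl
    have hsucc := pp_succ hp.1 (δ.length + j)
    cases a with
    | true =>
      by_cases hδZ : δ ∈ Z
      · rw [K2 δ hδZ]
        have hnZ := inZ δ hδZ _ (fun δ hd => by simp [hd]) p hp j hE
        refine (by decide : ∀ u : Fin 4, u = 2 ∨ u = 3 → ¬ pr true 2 u) _ ?_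
        cases hd : g.d (playPrefix p (δ.length + j)) with
        | true => exact R.exA _ hEn hd _ hsucc hS
        | false =>
          left
          have h1 : playPrefix p (δ.length + j + 1) = st (playPrefix p (δ.length + j)) :=
            hp.2.2 _ hn hEn (by simp [hd])
          rw [h1]
          exact exZ _ hnZ hd (h1 ▸ hS)
      · rw [K1 δ hδZ]
        exact (by decide : ∀ u, ¬ pr true 1 u) _
    | false =>
      cases hd : g.d (playPrefix p (δ.length + j)) with
      | true =>
        have h1 : playPrefix p (δ.length + j + 1) = st (playPrefix p (δ.length + j)) :=
          hp.2.2 _ hn hEn (by simp [hd])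
        exact absurd (h1 ▸ hS) (R.disj _ ((hst _ hEn).2.1 hd))
      | false =>
        have h3 := R.exB _ hEn hd _ hsucc hS
        have h0 := hx _ hEn hd _ hsucc hS
        by_cases hδZ : δ ∈ Z
        · rw [K2 δ hδZ]
          exact (by decide : ∀ u : Fin 4, u ≠ 3 → u ≠ 0 → ¬ pr false 2 u) _ h3 h0
        · rw [K1 δ hδZ]
          have hnZ := outZ δ hδ hδZ _ (fun δ hd => by simp [hd]) p hp j hE
          have h2 := (hbZ _ hEn hnZ hd _ hsucc).2 hS
          exact (by decide : ∀ u : Fin 4, u ≠ 3 → u ≠ 0 → u ≠ 2 → ¬ pr false 1 u) _ h3 h0 h2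

theorem Region.solve_any {α : Type*} {g : Game α Bool (Fin 4)} {S : Set (List α)}
    {f : List α → List α × Fin 4} {E : Set (List α)} {c : Fin 4} (R : Region g S f E c)
    (h : Sol g S f) (hne : E.Nonempty) :
    ∃ E' ⊆ E, E'.Nonempty ∧ ∃ f', Sol g (S ∪ E') f' ∧ EqOn f' f S := by
  by_cases hc : c = 3
  · subst hc
    refine ⟨E, subset_rfl, hne, R.solve_stay h fun δ hδ e he hS => ?_⟩
    cases hd : g.d δ with
    | true =>
      exact (by decide : ∀ u : Fin 4, u = 2 ∨ u = 3 → ¬ pr true 3 u) _ (R.exA δ hδ hd e he hS)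
    | false => exact (by decide : ∀ u : Fin 4, ¬ pr false 3 u) _
  by_cases hx : ∀ δ ∈ E, ∃ n, XR g S f E n δ
  · exact ⟨E, subset_rfl, hne, R.solve_x h hc hx⟩
  push Not at hx
  obtain ⟨δ0, hδ0, hx0⟩ := hx
  let E' : Set (List α) := {δ | δ ∈ E ∧ ∀ n, ¬ XR g S f E n δ}
  have hsucc : ∀ δ ∈ E', ∀ e ∈ treeSucc g.T δ, e ∈ E → e ∈ E' :=
    fun δ hδ e he heE => ⟨heE, fun n hn => hδ.2 (n + 1) ⟨e, he, heE, hn⟩⟩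
  have R' : Region g S f E' c :=
    { subT := fun δ hδ => R.subT hδ.1
      disj := fun δ hδ => R.disj δ hδ.1
      succ := fun δ hδ e he => (R.succ δ hδ.1 e he).imp_left (hsucc δ hδ e he)
      stay := fun δ hδ => by
        obtain ⟨e, h1, h2⟩ := R.stay δ hδ.1
        exact ⟨e, h1, hsucc δ hδ e h1 h2⟩
      const := fun p hp m hm => R.const p hp m fun n hn => (hm n hn).1
      exA := fun δ hδ => R.exA δ hδ.1
      exB := fun δ hδ => R.exB δ hδ.1 }
  have hx' : ∀ δ ∈ E', g.d δ = false → ∀ e ∈ treeSucc g.T δ, e ∈ S → (f e).2 ≠ 0 :=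
    fun δ hδ hd e he hS h0 => hδ.2 0 ⟨hd, e, he, hS, h0⟩
  refine ⟨E', fun δ hδ => hδ.1, ⟨δ0, hδ0, hx0⟩, ?_⟩
  by_cases h1 : c = 1
  · subst h1
    exact R'.solve_y h hx'
  · refine R'.solve_stay h fun δ hδ e he hS => ?_
    cases hd : g.d δ with
    | true =>
      exact (by decide : ∀ c u : Fin 4, u = 2 ∨ u = 3 → ¬ pr true c u) _ _
        (R'.exA δ hδ hd e he hS)
    | false =>
      exact (by decide : ∀ c u : Fin 4, c ≠ 3 → c ≠ 1 → u ≠ 3 → u ≠ 0 → ¬ pr false c u) _ _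
        hc h1 (R'.exB δ hδ hd e he hS) (hx' δ hδ hd e he hS)

theorem sub_play {α : Type*} [Inhabited α] {T : Set (List α)} (hT : IsTree T) {γ : List α}
    (hγ : γ ∈ T) {s : List α → List α} (hs : IsProfile {δ | γ ++ δ ∈ T} s) :
    listExtend γ (inducedPlay s) ∈ Body T ∧
      ∀ n, playPrefix (listExtend γ (inducedPlay s)) (γ.length + n) = γ ++ iterNode s [] n ∧
        γ ++ iterNode s [] n ∈ T := by
  have hmem : ∀ n, γ ++ iterNode s [] n ∈ T ∧ (iterNode s [] n).length = n := by
    intro n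
    induction n with
    | zero => simpa [iterNode] using hγ
    | succ n ih =>
      have := hs _ ih.1
      exact ⟨this.1, by rw [iterNode, this.2.2, ih.2]⟩
  have hpre : ∀ n, iterNode s [] n <+: iterNode s [] (n + 1) := fun n => (hs _ (hmem n).1).2.1
  have hind : ∀ n, playPrefix (inducedPlay s) n = iterNode s [] n := by
    intro n
    induction n with
    | zero => simp [playPrefix, iterNode]
    | succ n ih =>
      obtain ⟨l, hl⟩ := hpre n
      have hlen : l.length = 1 := by
        have := congrArg List.length hl
        rw [List.length_append, (hmem _).2, (hmem _).2] at this
        omega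
      obtain ⟨b, rfl⟩ := List.length_eq_one_iff.1 hlen
      have hb : inducedPlay s n = b := by
        unfold inducedPlay
        rw [← hl]
        simp [List.getD, (hmem n).2]
      have : playPrefix (inducedPlay s) (n + 1)
          = playPrefix (inducedPlay s) n ++ [inducedPlay s n] := by
        unfold playPrefix
        rw [List.ofFn_succ', List.concat_eq_append]
        rfl
      rw [this, ih, hb, hl]
  have hext : ∀ n, playPrefix (listExtend γ (inducedPlay s)) (γ.length + n)
      = γ ++ iterNode s [] n := by
    intro n
    rw [← hind]
    apply List.ext_getElem
    · simp [playPrefix]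
    · intro i h1 h2
      by_cases hi : i < γ.length
      · simp [playPrefix, listExtend, hi, List.getElem_append_left]
      · simp [playPrefix, listExtend, hi, List.getElem_append_right (not_lt.1 hi)]
  refine ⟨fun n => ?_, fun n => ⟨hext n, (hmem n).1⟩⟩
  refine hT (pp_prefix _ (Nat.le_add_left n γ.length)) ?_
  rw [hext]; exact (hmem n).1

theorem sub_profile {α : Type*} {T : Set (List α)} {s : List α → List α} (hs : IsProfile T s)
    (γ : List α) : IsProfile {δ | γ ++ δ ∈ T} (subProfile γ s) ∧
      ∀ δ, γ ++ δ ∈ T → γ ++ subProfile γ s δ = s (γ ++ δ) := by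
  have key : ∀ δ, γ ++ δ ∈ T → γ ++ subProfile γ s δ = s (γ ++ δ) := by
    intro δ hδ
    obtain ⟨l, hl⟩ := (hs _ hδ).2.1
    simp [subProfile, ← hl]
  refine ⟨fun δ hδ => ?_, key⟩
  have h := hs _ hδ
  rw [← key δ hδ] at h
  refine ⟨h.1, (List.prefix_append_right_inj γ).1 h.2.1, ?_⟩
  have := h.2.2
  simp only [List.length_append] at this
  omega

/-- The play through `γ` generated by a profile. -/
theorem exists_play {α : Type*} [Inhabited α] {T : Set (List α)} (hT : IsTree T) {γ : List α}
    (hγ : γ ∈ T) {s : List α → List α} (hs : IsProfile T s) :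
    ∃ p ∈ Body T, playPrefix p γ.length = γ ∧
      ∀ n, γ.length ≤ n → playPrefix p (n + 1) = s (playPrefix p n) := by
  obtain ⟨h1, h2⟩ := sub_profile hs γ
  obtain ⟨h3, h4⟩ := sub_play hT hγ h1
  refine ⟨_, h3, ?_, ?_⟩
  · have := (h4 0).1
    simpa [iterNode] using this
  · intro n hn
    obtain ⟨j, rfl⟩ := Nat.exists_eq_add_of_le hn
    rw [add_assoc, (h4 (j + 1)).1, (h4 j).1]
    exact h2 _ (h4 j).2

/-- A robust solution on all of `T` is a subgame perfect equilibrium. -/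
theorem Sol.spe {α : Type*} [Inhabited α] {g : Game α Bool (Fin 4)} (hT : IsTree g.T)
    (hpa : g.pref true = Ra) (hpb : g.pref false = Rb)
    {f : List α → List α × Fin 4} (h : Sol g g.T f) :
    ∃ s, IsProfile g.T s ∧ IsSPE g s := by
  have hs : IsProfile g.T fun γ => (f γ).1 := h.cl
  refine ⟨_, hs, ?_⟩
  rintro γ hγ ⟨c, s', hs', hdiff, hpref⟩
  obtain ⟨h1, h2⟩ := sub_profile hs γ
  obtain ⟨h3, h4⟩ := sub_play hT hγ h1
  obtain ⟨h5, h6⟩ := sub_play hT hγ hs'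
  have hp : g.pref c = pr c := by cases c <;> assumption
  have e1 : g.v (listExtend γ (inducedPlay (subProfile γ fun γ => (f γ).1))) = (f γ).2 := by
    refine h.val γ hγ _ ⟨h3, by simpa [iterNode] using (h4 0).1, fun n hn _ _ => ?_⟩
    obtain ⟨j, rfl⟩ := Nat.exists_eq_add_of_le hn
    rw [add_assoc, (h4 (j + 1)).1, (h4 j).1]
    exact h2 _ (h4 j).2
  refine h.rob γ hγ c (listExtend γ (inducedPlay s'))
    ⟨h5, by simpa [iterNode] using (h6 0).1, fun n hn _ hd => ?_⟩ ?_
  · obtain ⟨j, rfl⟩ := Nat.exists_eq_add_of_le hn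
    rw [add_assoc, (h6 (j + 1)).1, (h6 j).1]
    rw [(h6 j).1] at hd
    rw [← h2 _ (h6 j).2]
    by_contra hne
    refine hd (hdiff _ (h6 j).2 fun heq => hne ?_)
    rw [heq]; rfl
  · rw [← e1, ← hp]
    exact hpref

theorem Sol.max_all {α : Type*} [Inhabited α] {g : Game α Bool (Fin 4)} (hT : IsTree g.T)
    (hpr : IsPruned g.T)
    (hD : ∀ x : Fin 4, QuasiDiff g.T {p ∈ Body g.T | g.v p = x})
    {S : Set (List α)} {f : List α → List α × Fin 4} (h : Sol g S f)
    (hmax : ∀ S' f', Sol g S' f' → S ⊆ S' → EqOn f' f S → S' ⊆ S) : S = g.T := by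
  classical
  refine subset_antisymm h.sub fun γ0 hγ0 => ?_
  by_contra hγ0S
  -- one-node extensions are impossible
  have hone : ∀ γ ∈ g.T, γ ∉ S → ∀ γ' ∈ treeSucc g.T γ, γ' ∈ S →
      ¬ ∀ e ∈ treeSucc g.T γ, (∀ u, ¬ pr (g.d γ) (f γ').2 u) ∨
        (e ∈ S ∧ ¬ pr (g.d γ) (f γ').2 (f e).2) := by
    intro γ hγ hγS γ' hs hγ' hall
    obtain ⟨f', h1, h2⟩ := h.one hγ hγS hγ' hs hall
    exact hγS (hmax _ _ h1 subset_union_left h2 (Or.inr rfl))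
  have exA : ∀ δ ∈ g.T, δ ∉ S → g.d δ = true → ∀ e ∈ treeSucc g.T δ, e ∈ S →
      (f e).2 = 2 ∨ (f e).2 = 3 := by
    intro δ hδ hδS hd e he heS
    by_contra hcon
    refine hone δ hδ hδS e he heS fun _ _ => Or.inl ?_
    rw [hd]
    exact (by decide : ∀ w : Fin 4, ¬ (w = 2 ∨ w = 3) → ∀ u, ¬ pr true w u) _ hcon
  have exB : ∀ δ ∈ g.T, δ ∉ S → g.d δ = false → ∀ e ∈ treeSucc g.T δ, e ∈ S →
      (f e).2 ≠ 3 := by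
    intro δ hδ hδS hd e he heS hcon
    refine hone δ hδ hδS e he heS fun _ _ => Or.inl ?_
    rw [hd, hcon]
    decide
  have hstay : ∀ δ ∈ g.T, δ ∉ S → ∃ e ∈ treeSucc g.T δ, e ∉ S := by
    intro δ hδ hδS
    by_contra hcon
    push Not at hcon
    obtain ⟨e0, he0⟩ := hpr δ hδ
    cases hd : g.d δ with
    | true =>
      refine hone δ hδ hδS e0 he0 (hcon _ he0) fun e he => Or.inr ⟨hcon e he, ?_⟩
      rw [hd]
      exact (by decide : ∀ w u : Fin 4, (u = 2 ∨ u = 3) → ¬ pr true w u) _ _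
        (exA δ hδ hδS hd e he (hcon e he))
    | false =>
      have hfin : (((fun e => rankB (f e).2) '' treeSucc g.T δ)).Finite :=
        (Set.toFinite (range rankB)).subset (by rintro _ ⟨e, -, rfl⟩; exact ⟨_, rfl⟩)
      obtain ⟨_, ⟨e1, he1, rfl⟩, hm'⟩ := Set.exists_max_image _ id hfin ⟨_, e0, he0, rfl⟩
      have hm : ∀ e ∈ treeSucc g.T δ, rankB (f e).2 ≤ rankB (f e1).2 :=
        fun e he => hm' _ ⟨e, he, rfl⟩
      refine hone δ hδ hδS e1 he1 (hcon _ he1) fun e he => Or.inr ⟨hcon e he, ?_⟩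
      rw [hd]
      exact not_lt.2 (hm e he)
  -- a play staying outside `S`
  have hprof : ∀ δ, ∃ e, δ ∈ g.T → e ∈ treeSucc g.T δ ∧ (δ ∉ S → e ∉ S) := by
    intro δ
    by_cases hδ : δ ∈ g.T
    · by_cases hδS : δ ∈ S
      · obtain ⟨e, he⟩ := hpr δ hδ
        exact ⟨e, fun _ => ⟨he, fun h => absurd hδS h⟩⟩
      · obtain ⟨e, he, heS⟩ := hstay δ hδ hδS
        exact ⟨e, fun _ => ⟨he, fun _ => heS⟩⟩
    · exact ⟨δ, fun h => absurd h hδ⟩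
  choose ch hch using hprof
  obtain ⟨p, hp, hpγ, hpn⟩ := exists_play hT hγ0 (s := ch) fun δ hδ => (hch δ hδ).1
  let F : Set (ℕ → α) := {p | p ∈ Body g.T ∧ playPrefix p γ0.length = γ0 ∧
    ∀ n, γ0.length ≤ n → playPrefix p n ∉ S}
  have hpF : p ∈ F := by
    refine ⟨hp, hpγ, fun n hn => ?_⟩
    induction n, hn using Nat.le_induction with
    | base => rw [hpγ]; exact hγ0S
    | succ n hn ih => rw [hpn n hn]; exact (hch _ (hp n)).2 ih
  obtain ⟨q, hq, m, hm, -, hconst⟩ :=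
    v_local hD F (fun p hp => hp.1) p hpF γ0.length
  let E : Set (List α) := {δ | δ ∈ g.T ∧ playPrefix q m <+: δ ∧
    ∀ δ', playPrefix q m <+: δ' → δ' <+: δ → δ' ∉ S}
  have hEsucc : ∀ δ ∈ E, ∀ e ∈ treeSucc g.T δ, e ∉ S → e ∈ E := by
    intro δ hδ e he heS
    refine ⟨he.1, hδ.2.1.trans he.2.1, fun δ' h1 h2 => ?_⟩
    by_cases hl : δ'.length ≤ δ.length
    · exact hδ.2.2 δ' h1 (List.prefix_of_prefix_length_le h2 he.2.1 hl)
    · have : δ' = e := h2.eq_of_length (by have := h2.length_le; have := he.2.2; omega)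
      rw [this]; exact heS
  have R : Region g S f E (g.v q) :=
    { subT := fun δ hδ => hδ.1
      disj := fun δ hδ => hδ.2.2 δ hδ.2.1 List.prefix_rfl
      succ := fun δ hδ e he => by
        by_cases heS : e ∈ S
        · exact Or.inr heS
        · exact Or.inl (hEsucc δ hδ e he heS)
      stay := fun δ hδ => by
        obtain ⟨e, h1, h2⟩ := hstay δ hδ.1 (hδ.2.2 δ hδ.2.1 List.prefix_rfl)
        exact ⟨e, h1, hEsucc δ hδ e h1 h2⟩
      const := fun r hr k hk => by
        have hrm : playPrefix r m = playPrefix q m := by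
          have := pp_of_prefix (hk k le_rfl).2.1
          rwa [pp_length] at this
        refine hconst r ⟨hr, ?_, fun n hn => ?_⟩ hrm
        · rw [pp_mono hm hrm]; exact hq.2.1
        · rcases le_total n m with hnm | hnm
          · rw [pp_mono hnm hrm]; exact hq.2.2 n hn
          · refine (hk (max n k) (le_max_right _ _)).2.2 _ ?_ (pp_prefix r (le_max_left _ _))
            rw [← hrm]; exact pp_prefix r hnm
      exA := fun δ hδ => exA δ hδ.1 (hδ.2.2 δ hδ.2.1 List.prefix_rfl)
      exB := fun δ hδ => exB δ hδ.1 (hδ.2.2 δ hδ.2.1 List.prefix_rfl) }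
  have hqE : playPrefix q m ∈ E := by
    refine ⟨hq.1 m, List.prefix_rfl, fun δ' h1 h2 => ?_⟩
    rw [← h1.eq_of_length_le h2.length_le]
    exact hq.2.2 m hm
  obtain ⟨E', hE', ⟨δ, hδ⟩, f', h1, h2⟩ := R.solve_any h ⟨_, hqE⟩
  exact R.disj δ (hE' hδ) (hmax _ _ h1 subset_union_left h2 (Or.inr hδ))

end Helpers

/-- every two-player game with preferences `≺_a` and `≺_b`, on a countable
pruned tree over a countable alphabet, whose outcome fibers are quasi-difference sets,
has a subgame perfect equilibrium. Players: `true = a`, `false = b`. -/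
theorem stmt12 {α : Type*} [Inhabited α] [Countable α] (g : Game α Bool (Fin 4))
    (hT : IsTree g.T) (hne : g.T.Nonempty) (hpr : IsPruned g.T) (hTc : g.T.Countable)
    (hpa : g.pref true = Ra) (hpb : g.pref false = Rb)
    (hD : ∀ x : Fin 4, QuasiDiff g.T {p ∈ Body g.T | g.v p = x}) :
    ∃ s, IsProfile g.T s ∧ IsSPE g s := by
  obtain ⟨S, f, h, hmax⟩ := Sol.exists_max g
  have hS := h.max_all hT hpr hD hmax
  subst hS
  exact h.spe hT hpa hpb
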